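/- Let m ≥ 1, u ∈ ℝᵐ and t = |u|², and suppose α(t)φ(t) ≠ 0, α₁(t)·(α₁+α₃)(t) ≠ 0 and φ₁(t)·(φ₁+φ₃)(t) ≠ 0. Set λ₁ = α(t)/α₁(t) and λ₂ = [φ₁(t)·(α₁(t)(β₁+β₃)(t) − α₂(t)β₂(t) − φ₂(t)β₂(t)) + β₁(t)·φ₂(t)²]/(α₁(t)·φ₁(t)). Then μ(λ₁,λ₂,u) is invertible and its inverse has (i,j) entry (α₁(t)/α(t))·δᵢⱼ − ψ_λ(t)·uⁱuʲ. -/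

import Mathlib

open Matrix

/-- The `m × m` real matrix with `(i,j)` entry `a·δᵢⱼ + b·uⁱuʲ`. -/
def mu {m : ℕ} (a b : ℝ) (u : Fin m → ℝ) : Matrix (Fin m) (Fin m) ℝ :=
  Matrix.of fun i j => a * (if i = j then (1 : ℝ) else 0) + b * u i * u j

theorem mu_mul_mu {m : ℕ} (a b c d : ℝ) (u : Fin m → ℝ) :
    mu a b u * mu c d u = mu (a * c) (a * d + b * c + b * d * ∑ i, u i ^ 2) u := by
  have h (x y : ℝ) : mu x y u = x • (1 : Matrix (Fin m) (Fin m) ℝ) + y • vecMulVec u u := by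
    ext i j
    simp [mu, Matrix.one_apply, vecMulVec_apply, mul_assoc]
  have hu : vecMulVec u u * vecMulVec u u = (∑ i, u i ^ 2) • vecMulVec u u := by
    ext i j
    simp only [Matrix.mul_apply, vecMulVec_apply, Matrix.smul_apply, smul_eq_mul, Finset.sum_mul]
    exact Finset.sum_congr rfl fun k _ => by ring
  simp only [h, add_mul, mul_add, smul_mul_smul_comm, one_mul, mul_one, hu]
  module

theorem mu_one_zero {m : ℕ} (u : Fin m → ℝ) : mu 1 0 u = 1 := by
  ext i j
  simp [mu, Matrix.one_apply]

/-- A Sherman–Morrison formula for `mu a b u`. -/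
theorem mu_mul_mu_eq_one {m : ℕ} {a b c d : ℝ} {u : Fin m → ℝ} (hac : a * c = 1)
    (hd : (a + b * ∑ i, u i ^ 2) * d + b * c = 0) : mu a b u * mu c d u = 1 := by
  rw [mu_mul_mu, hac, ← mu_one_zero u]
  congr 1
  linear_combination hd

theorem stmt3 (m : ℕ) (hm : 1 ≤ m) (α₁ α₂ α₃ β₁ β₂ β₃ : ℝ → ℝ)
    (u : Fin m → ℝ) (t : ℝ) (ht : t = ∑ i, u i ^ 2)
    (φ₁ φ₂ φ₃ A Φ : ℝ)
    (hφ₁ : φ₁ = α₁ t + t * β₁ t) (hφ₂ : φ₂ = α₂ t + t * β₂ t)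
    (hφ₃ : φ₃ = α₃ t + t * β₃ t)
    (hA : A = α₁ t * (α₁ t + α₃ t) - α₂ t ^ 2)
    (hΦ : Φ = φ₁ * (φ₁ + φ₃) - φ₂ ^ 2)
    (h1 : A * Φ ≠ 0) (h2 : α₁ t * (α₁ t + α₃ t) ≠ 0)
    (h3 : φ₁ * (φ₁ + φ₃) ≠ 0)
    (lam₁ lam₂ ψlam : ℝ)
    (hlam₁ : lam₁ = A / α₁ t)
    (hlam₂ : lam₂ = (φ₁ * (α₁ t * (β₁ t + β₃ t) - α₂ t * β₂ t - φ₂ * β₂ t)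
        + β₁ t * φ₂ ^ 2) / (α₁ t * φ₁))
    (hψlam : ψlam = (α₁ t * ((β₁ t + β₃ t) * φ₁ - β₂ t * φ₂)
        - α₂ t * (α₁ t * β₂ t - α₂ t * β₁ t)) / (A * Φ)) :
    IsUnit (mu lam₁ lam₂ u) ∧
      ∀ i j, (mu lam₁ lam₂ u)⁻¹ i j =
        α₁ t / A * (if i = j then (1 : ℝ) else 0) - ψlam * u i * u j := by
  have hA0 : A ≠ 0 := left_ne_zero_of_mul h1
  have hΦ0 : Φ ≠ 0 := right_ne_zero_of_mul h1
  have hα0 : α₁ t ≠ 0 := left_ne_zero_of_mul h2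
  have hφ0 : φ₁ ≠ 0 := left_ne_zero_of_mul h3
  have hsum : lam₁ + lam₂ * t = Φ / φ₁ := by
    rw [hlam₁, hlam₂]
    field_simp
    rw [hA, hΦ, hφ₁, hφ₂, hφ₃]
    ring
  have hψ : ψlam = lam₂ * (α₁ t * φ₁) / (A * Φ) := by
    rw [hψlam, hlam₂, div_mul_cancel₀ _ (mul_ne_zero hα0 hφ0), hφ₁, hφ₂]
    ring
  have hmul : mu lam₁ lam₂ u * mu (α₁ t / A) (-ψlam) u = 1 := by
    apply mu_mul_mu_eq_one
    · rw [hlam₁]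
      field_simp
    · rw [← ht, hsum, hψ]
      field_simp
      ring
  refine ⟨(Matrix.isUnit_iff_isUnit_det _).2 (Matrix.isUnit_det_of_right_inverse hmul), ?_⟩
  intro i j
  rw [Matrix.inv_eq_right_inv hmul]
  simp only [mu, Matrix.of_apply]
  ring
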